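/- Let w_1, ..., w_m be i.i.d. standard Gaussian random vectors on ℝ^d and let φ be the PRF map with m features. Let q, k_1, ..., k_n ∈ ℝ^d with ‖q‖ ≤ R and ‖k_j‖ ≤ R for all j, and let ε > 0, δ ∈ (0,1). If m ≥ n·exp(4R²) / (ε²·δ), then Pr(∃ j ∈ {1,...,n} : |⟨φ(q), φ(k_j)⟩ − exp(⟨q, k_j⟩)| ≥ ε·exp(⟨q, k_j⟩)) ≤ δ. -/

import Mathlib

open MeasureTheory ProbabilityTheory

/-- The joint law of `m` i.i.d. standard Gaussian random vectors on `ℝ^d`. -/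
noncomputable def iidStdGaussian (m d : ℕ) : Measure (Fin m → Fin d → ℝ) :=
  Measure.pi fun _ => Measure.pi fun _ => gaussianReal 0 1

/-- The Positive Random Feature (PRF) map with `m` features:
`φ(x)_i = (exp (−‖x‖²/2)/√m) · exp ⟨w_i, x⟩`. -/
noncomputable def prf (m d : ℕ) (W : Fin m → Fin d → ℝ) (x : Fin d → ℝ) : Fin m → ℝ :=
  fun i => (Real.exp (-(∑ j, (x j) ^ 2) / 2) / Real.sqrt m) * Real.exp (∑ j, W i j * x j)

lemma integrable_exp_sum_mul_gaussianReal {ι : Type*} [Fintype ι] (v : ι → ℝ) :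
    Integrable (fun w : ι → ℝ => Real.exp (∑ j, w j * v j))
      (Measure.pi fun _ : ι => gaussianReal 0 1) := by
  simp_rw [Real.exp_sum]
  refine Integrable.fintype_prod_dep (f := fun j (x : ℝ) => Real.exp (x * v j)) fun j => ?_
  simpa only [mul_comm] using integrable_exp_mul_gaussianReal (μ := 0) (v := 1) (v j)

lemma integral_exp_sum_mul_gaussianReal {ι : Type*} [Fintype ι] (v : ι → ℝ) :
    ∫ w : ι → ℝ, Real.exp (∑ j, w j * v j) ∂(Measure.pi fun _ : ι => gaussianReal 0 1)
      = Real.exp ((∑ j, (v j) ^ 2) / 2) := by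
  simp_rw [Real.exp_sum]
  rw [integral_fintype_prod_eq_prod (fun j (x : ℝ) => Real.exp (x * v j)), Finset.sum_div,
    Real.exp_sum]
  refine Finset.prod_congr rfl fun j _ => ?_
  have h := congrFun (mgf_id_gaussianReal (μ := 0) (v := 1)) (v j)
  simpa [mgf, mul_comm] using h

/-- Chebyshev's inequality for a sum of i.i.d. square-integrable random variables. -/
lemma pi_meas_ge_le_variance_div_sq {ι Ω : Type*} [Fintype ι] [MeasurableSpace Ω]
    {μ : Measure Ω} [IsProbabilityMeasure μ] {f : Ω → ℝ} (hf : MemLp f 2 μ)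
    {c : ℝ} (hc : 0 < c) :
    Measure.pi (fun _ : ι => μ) {ω | c ≤ |(∑ i, f (ω i)) - Fintype.card ι * μ[f]|}
      ≤ ENNReal.ofReal (Fintype.card ι * Var[f; μ] / c ^ 2) := by
  have hmem (i : ι) : MemLp (fun ω : ι → Ω => f (ω i)) 2 (Measure.pi fun _ => μ) :=
    hf.comp_measurePreserving (measurePreserving_eval (fun _ : ι => μ) i)
  have hsum : MemLp (∑ i, fun ω : ι → Ω => f (ω i)) 2 (Measure.pi fun _ => μ) :=
    memLp_finsetSum' _ fun i _ => hmem i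
  have hmean : (Measure.pi fun _ : ι => μ)[∑ i, fun ω : ι → Ω => f (ω i)]
      = (Fintype.card ι : ℝ) * μ[f] := by
    simp_rw [Finset.sum_apply]
    rw [integral_finsetSum _ fun i _ => (hmem i).integrable one_le_two]
    simp_rw [integral_comp_eval (μ := fun _ : ι => μ) hf.1]
    simp
  have hvar : Var[∑ i, fun ω : ι → Ω => f (ω i); Measure.pi fun _ => μ]
      = Fintype.card ι * Var[f; μ] := by
    rw [variance_sum_pi (μ := fun _ : ι => μ) (X := fun _ => f) fun _ => hf]
    simp
  have h := meas_ge_le_variance_div_sq hsum hc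
  rw [hmean, hvar] at h
  simpa only [Finset.sum_apply] using h

lemma prf_mul_prf (m d : ℕ) (W : Fin m → Fin d → ℝ) (x y : Fin d → ℝ) (l : Fin m) :
    prf m d W x l * prf m d W y l
      = Real.exp (-(∑ j, (x j) ^ 2 + ∑ j, (y j) ^ 2) / 2) / m
        * Real.exp (∑ j, W l j * (x + y) j) := by
  have h1 : Real.exp (∑ j, W l j * (x + y) j)
      = Real.exp (∑ j, W l j * x j) * Real.exp (∑ j, W l j * y j) := by
    rw [← Real.exp_add, ← Finset.sum_add_distrib]
    simp only [Pi.add_apply, mul_add]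
  have h2 : Real.exp (-(∑ j, (x j) ^ 2 + ∑ j, (y j) ^ 2) / 2)
      = Real.exp (-(∑ j, (x j) ^ 2) / 2) * Real.exp (-(∑ j, (y j) ^ 2) / 2) := by
    rw [← Real.exp_add]
    ring_nf
  have h3 : (m : ℝ) = Real.sqrt m * Real.sqrt m := (Real.mul_self_sqrt m.cast_nonneg).symm
  rw [h1, h2, h3, prf, prf, mul_div_mul_comm]
  ring

lemma sum_add_sq {ι : Type*} [Fintype ι] (x y : ι → ℝ) :
    ∑ j, ((x + y) j) ^ 2 = ∑ j, (x j) ^ 2 + ∑ j, (y j) ^ 2 + 2 * ∑ j, x j * y j := by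
  rw [Finset.mul_sum, ← Finset.sum_add_distrib, ← Finset.sum_add_distrib]
  exact Finset.sum_congr rfl fun j _ => by simp only [Pi.add_apply]; ring

/-- The PRF estimator of `exp ⟨x, y⟩` has relative error at least `ε` with probability at most
`exp (‖x + y‖²) / (m ε²)`. -/
lemma prf_relative_error_le (m d : ℕ) (hm : 0 < m) (x y : Fin d → ℝ) {ε : ℝ} (hε : 0 < ε) :
    iidStdGaussian m d
        {W | ε * Real.exp (∑ j, x j * y j) ≤
          |(∑ l, prf m d W x l * prf m d W y l) - Real.exp (∑ j, x j * y j)|}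
      ≤ ENNReal.ofReal (Real.exp (∑ j, ((x + y) j) ^ 2) / (m * ε ^ 2)) := by
  have hm0 : (0 : ℝ) < m := Nat.cast_pos.2 hm
  set μ : Measure (Fin d → ℝ) := Measure.pi fun _ => gaussianReal 0 1
  set C := Real.exp (-(∑ j, (x j) ^ 2 + ∑ j, (y j) ^ 2) / 2) with hC
  set f : (Fin d → ℝ) → ℝ := fun w => C / m * Real.exp (∑ j, w j * (x + y) j) with hfdef
  have hsq : (fun w => f w ^ 2)
      = fun w => (C / m) ^ 2 * Real.exp (∑ j, w j * (2 * (x + y) j)) := by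
    funext w
    rw [hfdef, mul_pow, ← Real.exp_nat_mul, Finset.mul_sum]
    congr 2
    refine Finset.sum_congr rfl fun j _ => ?_
    push_cast
    ring
  have hmeas : AEStronglyMeasurable f μ :=
    ((integrable_exp_sum_mul_gaussianReal (x + y)).const_mul _).1
  have hf : MemLp f 2 μ := by
    rw [memLp_two_iff_integrable_sq hmeas, hsq]
    exact (integrable_exp_sum_mul_gaussianReal fun j => 2 * (x + y) j).const_mul _
  have hmean : m * μ[f] = Real.exp (∑ j, x j * y j) := by
    rw [hfdef, integral_const_mul, integral_exp_sum_mul_gaussianReal, sum_add_sq, ← mul_assoc,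
      mul_div_cancel₀ _ hm0.ne', hC, ← Real.exp_add]
    ring_nf
  have hsecond : μ[f ^ 2]
      = Real.exp (∑ j, x j * y j) ^ 2 * Real.exp (∑ j, ((x + y) j) ^ 2) / m ^ 2 := by
    change ∫ w, f w ^ 2 ∂μ = _
    rw [hsq, integral_const_mul, integral_exp_sum_mul_gaussianReal, div_pow, div_mul_eq_mul_div,
      hC, ← Real.exp_nat_mul, ← Real.exp_nat_mul, ← Real.exp_add, ← Real.exp_add]
    simp_rw [mul_pow]
    rw [← Finset.mul_sum, sum_add_sq]
    push_cast
    ring_nf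
  have h := pi_meas_ge_le_variance_div_sq (ι := Fin m) hf
    (mul_pos hε (Real.exp_pos (∑ j, x j * y j)))
  rw [Fintype.card_fin, hmean] at h
  simp_rw [prf_mul_prf]
  refine h.trans (ENNReal.ofReal_le_ofReal ?_)
  calc m * Var[f; μ] / (ε * Real.exp (∑ j, x j * y j)) ^ 2
      ≤ m * μ[f ^ 2] / (ε * Real.exp (∑ j, x j * y j)) ^ 2 := by
        gcongr
        exact variance_le_expectation_sq hmeas
    _ = Real.exp (∑ j, ((x + y) j) ^ 2) / (m * ε ^ 2) := by
        rw [hsecond]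
        have := (Real.exp_pos (∑ j, x j * y j)).ne'
        field_simp

lemma sum_add_sq_le_of_sqrt_le {ι : Type*} [Fintype ι] {x y : ι → ℝ} {R : ℝ}
    (hx : Real.sqrt (∑ j, (x j) ^ 2) ≤ R) (hy : Real.sqrt (∑ j, (y j) ^ 2) ≤ R) :
    ∑ j, ((x + y) j) ^ 2 ≤ 4 * R ^ 2 := by
  have hx' := (Real.sqrt_le_iff.1 hx).2
  have hy' := (Real.sqrt_le_iff.1 hy).2
  have h : ∑ j, ((x + y) j) ^ 2 ≤ ∑ j, (2 * (x j) ^ 2 + 2 * (y j) ^ 2) :=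
    Finset.sum_le_sum fun j _ => by
      simp only [Pi.add_apply]
      nlinarith [sq_nonneg (x j - y j)]
  rw [Finset.sum_add_distrib, ← Finset.mul_sum, ← Finset.mul_sum] at h
  linarith

/-- Union bound for the PRF estimator over `n` keys: if
`m ≥ n exp (4R²) / (ε² δ)`, then with probability at least `1 − δ`, every key
satisfies the relative-error bound `|⟨φ(q), φ(k_j)⟩ − exp ⟨q, k_j⟩| < ε exp ⟨q, k_j⟩`. -/
theorem prf_union_bound (m d n : ℕ) (hm : 0 < m) (q : Fin d → ℝ) (k : Fin n → Fin d → ℝ)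
    (R : ℝ) (hR : 0 < R) (hq : Real.sqrt (∑ j, (q j) ^ 2) ≤ R)
    (hk : ∀ i, Real.sqrt (∑ j, (k i j) ^ 2) ≤ R)
    (ε δ : ℝ) (hε : 0 < ε) (hδ0 : 0 < δ) (hδ1 : δ < 1)
    (hm' : n * Real.exp (4 * R ^ 2) / (ε ^ 2 * δ) ≤ m) :
    iidStdGaussian m d
        {W | ∃ i : Fin n, ε * Real.exp (∑ j, q j * k i j) ≤
          |(∑ l, prf m d W q l * prf m d W (k i) l) - Real.exp (∑ j, q j * k i j)|}
      ≤ ENNReal.ofReal δ := by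
  have hm0 : (0 : ℝ) < m := Nat.cast_pos.2 hm
  rw [Set.ofPred_exists]
  refine (measure_iUnion_fintype_le _ _).trans ?_
  calc ∑ i, iidStdGaussian m d {W | ε * Real.exp (∑ j, q j * k i j) ≤
          |(∑ l, prf m d W q l * prf m d W (k i) l) - Real.exp (∑ j, q j * k i j)|}
      ≤ ∑ _i : Fin n, ENNReal.ofReal (Real.exp (4 * R ^ 2) / (m * ε ^ 2)) := by
        refine Finset.sum_le_sum fun i _ => ?_
        refine (prf_relative_error_le m d hm q (k i) hε).trans (ENNReal.ofReal_le_ofReal ?_)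
        gcongr
        exact sum_add_sq_le_of_sqrt_le hq (hk i)
    _ = ENNReal.ofReal (n * (Real.exp (4 * R ^ 2) / (m * ε ^ 2))) := by
        rw [← ENNReal.ofReal_sum_of_nonneg fun _ _ => by positivity]
        simp
    _ ≤ ENNReal.ofReal δ := by
        refine ENNReal.ofReal_le_ofReal ?_
        rw [div_le_iff₀ (by positivity)] at hm'
        rw [← mul_div_assoc, div_le_iff₀ (by positivity)]
        linarith
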